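/- arXiv:2209.04581 — 3 statements merged into one kernel-verified Lean document; each statement's English description precedes it below -/
import Mathlib

section
/- Pendant reduction rule for scaffolds: let (V, E, s, t, X, w, r) be an m-rooted scaffold datum, let v ∈ V be a node not in the range of the root list r that is incident to exactly one edge e ∈ E, with s(e) = u ≠ v and t(e) = v, and suppose every row sum of the matrix w(e) equals α. Then the value of the scaffold equals α times the value of the scaffold on nodes V∖{v} and edges E∖{e} with the restricted endpoint maps, weights, and the same root list. -/
open Finset

/-- The value of an `m`-rooted scaffold datum `(V, E, s, t, X, w, r)`: the tensor
`S : (Fin m → X) → ℂ` with `S f = Σ_{φ : V → X, φ∘r = f} Π_{e ∈ E} w(e)_{φ(s e), φ(t e)}`. -/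
noncomputable def scaffold {V E X : Type} [Fintype V] [Fintype E] [Fintype X] [DecidableEq V] [DecidableEq X]
    {m : ℕ} (s t : E → V) (w : E → Matrix X X ℂ) (r : Fin m → V) (f : Fin m → X) : ℂ :=
  ∑ φ : V → X, if φ ∘ r = f then ∏ e : E, w e (φ (s e)) (φ (t e)) else 0

/-- pendant reduction rule for scaffolds. If `v` is a non-root node
incident to exactly one edge `e₀`, with `s e₀ = u ≠ v` and `t e₀ = v`, and every row sum
of `w e₀` equals `α`, then the scaffold value equals `α` times the value of the scaffold
on nodes `V ∖ {v}` and edges `E ∖ {e₀}` with the restricted endpoint maps, weights and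
the same root list. -/
theorem stmt_1 {V E X : Type} [Fintype V] [Fintype E] [Fintype X]
    [DecidableEq V] [DecidableEq E] [DecidableEq X] {m : ℕ}
    (s t : E → V) (w : E → Matrix X X ℂ) (r : Fin m → V)
    (v : V) (e₀ : E) (u : V)
    (hroot : ∀ i, r i ≠ v)
    (hinc : ∀ e, (s e = v ∨ t e = v) ↔ e = e₀)
    (hs : s e₀ = u) (ht : t e₀ = v) (huv : u ≠ v)
    (α : ℂ) (hrow : ∀ x : X, ∑ y : X, w e₀ x y = α)
    (f : Fin m → X) :
    scaffold s t w r f =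
      α * scaffold
        (fun e : {e : E // e ≠ e₀} =>
          (⟨s e.1, fun h => e.2 ((hinc e.1).mp (Or.inl h))⟩ : {a : V // a ≠ v}))
        (fun e : {e : E // e ≠ e₀} =>
          (⟨t e.1, fun h => e.2 ((hinc e.1).mp (Or.inr h))⟩ : {a : V // a ≠ v}))
        (fun e : {e : E // e ≠ e₀} => w e.1)
        (fun i => (⟨r i, hroot i⟩ : {a : V // a ≠ v})) f := by
  unfold scaffold
  rw [← (Equiv.funSplitAt v X).symm.sum_comp, Fintype.sum_prod_type_right, Finset.mul_sum]
  refine Finset.sum_congr rfl fun ψ _ => ?_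
  have off_v (x : X) (a : V) (ha : a ≠ v) :
      (Equiv.funSplitAt v X).symm (x, ψ) a = ψ ⟨a, ha⟩ := by
    simp [Equiv.funSplitAt, Equiv.piSplitAt, ha]
  have at_v (x : X) : (Equiv.funSplitAt v X).symm (x, ψ) v = x := by
    simp [Equiv.funSplitAt, Equiv.piSplitAt]
  have root_cond (x : X) : (Equiv.funSplitAt v X).symm (x, ψ) ∘ r =
      ψ ∘ fun i => (⟨r i, hroot i⟩ : {a : V // a ≠ v}) :=
    funext fun i => off_v x (r i) (hroot i)
  simp only [root_cond]
  split_ifs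
  · rw [← hrow (ψ ⟨u, huv⟩), Finset.sum_mul]
    refine Finset.sum_congr rfl fun x _ => ?_
    rw [Fintype.prod_eq_mul_prod_subtype_ne _ e₀, ht, at_v, hs, off_v x u huv]
    congr 1
    refine Finset.prod_congr rfl fun e _ => ?_
    rw [off_v x (s e.1) fun h => e.2 ((hinc e.1).mp (Or.inl h)),
      off_v x (t e.1) fun h => e.2 ((hinc e.1).mp (Or.inr h))]
  · simp
end

section
/- Series reduction rule for scaffolds: let (V, E, s, t, X, w, r) be an m-rooted scaffold datum and let v ∈ V be a node not in the range of the root list that is incident to exactly two distinct edges e₁, e₂, with s(e₁) = u, t(e₁) = v, s(e₂) = v, t(e₂) = x, and u ≠ v, x ≠ v. Then the value of the scaffold equals the value of the scaffold on nodes V∖{v} in which the edges e₁ and e₂ are replaced by a single new edge from u to x with weight equal to the matrix product w(e₁)·w(e₂), all other data unchanged. -/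
open Finset

/-- series reduction rule for scaffolds. Let `v` be a non-root node
incident to exactly the two distinct edges `e₁, e₂`, with `s e₁ = u`, `t e₁ = v`,
`s e₂ = v`, `t e₂ = x₀`, `u ≠ v`, `x₀ ≠ v`.  Then the scaffold value equals the value
of the scaffold on nodes `V ∖ {v}` in which the edges `e₁` and `e₂` are replaced by a
single new edge from `u` to `x₀` with weight the matrix product `w e₁ * w e₂`, all
other data unchanged. -/
theorem stmt_3 {V E X : Type} [Fintype V] [Fintype E] [Fintype X]
    [DecidableEq V] [DecidableEq E] [DecidableEq X] {m : ℕ}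
    (s t : E → V) (w : E → Matrix X X ℂ) (r : Fin m → V)
    (v u x₀ : V) (e₁ e₂ : E) (hee : e₁ ≠ e₂)
    (hroot : ∀ i, r i ≠ v)
    (hinc : ∀ e, (s e = v ∨ t e = v) ↔ (e = e₁ ∨ e = e₂))
    (hs₁ : s e₁ = u) (ht₁ : t e₁ = v) (hs₂ : s e₂ = v) (ht₂ : t e₂ = x₀)
    (huv : u ≠ v) (hxv : x₀ ≠ v)
    (f : Fin m → X) :
    scaffold s t w r f =
      scaffold
        (fun e : {e : E // e ≠ e₁} =>
          if h : e.1 = e₂ then (⟨u, huv⟩ : {a : V // a ≠ v})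
          else ⟨s e.1, fun hsv => ((hinc e.1).mp (Or.inl hsv)).elim e.2 h⟩)
        (fun e : {e : E // e ≠ e₁} =>
          if h : e.1 = e₂ then (⟨x₀, hxv⟩ : {a : V // a ≠ v})
          else ⟨t e.1, fun htv => ((hinc e.1).mp (Or.inr htv)).elim e.2 h⟩)
        (fun e : {e : E // e ≠ e₁} => if e.1 = e₂ then w e₁ * w e₂ else w e.1)
        (fun i => (⟨r i, hroot i⟩ : {a : V // a ≠ v})) f := by
  have restrict_eq : ∀ (a : X) (ψ : {b : V // b ≠ v} → X) (b : V) (hb : b ≠ v),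
      (Equiv.funSplitAt v X).symm (a, ψ) b = ψ ⟨b, hb⟩ := fun a ψ b hb => by
    simp [Equiv.funSplitAt, hb]
  have at_self : ∀ (a : X) (ψ : {b : V // b ≠ v} → X),
      (Equiv.funSplitAt v X).symm (a, ψ) v = a := fun a ψ => by
    simp [Equiv.funSplitAt]
  unfold scaffold
  rw [← (Equiv.funSplitAt v X).symm.sum_comp, Fintype.sum_prod_type_right]
  refine Fintype.sum_congr _ _ fun ψ => ?_
  have root_iff : ∀ a : X, (Equiv.funSplitAt v X).symm (a, ψ) ∘ r = f ↔
      (ψ ∘ fun i => (⟨r i, hroot i⟩ : {b : V // b ≠ v})) = f := fun a => by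
    simp only [funext_iff, Function.comp_apply, restrict_eq a ψ _ (hroot _)]
  simp only [root_iff]
  split_ifs with hψ
  swap
  · simp
  rw [← Finset.mul_prod_erase univ _ (mem_univ (⟨e₂, hee.symm⟩ : {e : E // e ≠ e₁}))]
  simp only [dite_true, if_true, Matrix.mul_apply]
  rw [Finset.sum_mul]
  refine Fintype.sum_congr _ _ fun a => ?_
  rw [Fintype.prod_eq_mul_prod_subtype_ne _ e₁,
    ← Finset.mul_prod_erase univ _ (mem_univ (⟨e₂, hee.symm⟩ : {e : E // e ≠ e₁})), ← mul_assoc]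
  simp only [hs₁, ht₁, hs₂, ht₂, at_self, restrict_eq a ψ u huv, restrict_eq a ψ x₀ hxv]
  congr 1
  refine Finset.prod_congr rfl fun e he => ?_
  have hne : e.1 ≠ e₂ := fun h => (Finset.mem_erase.mp he).1 (Subtype.ext h)
  have hs : s e.1 ≠ v := fun h => ((hinc e.1).mp (Or.inl h)).elim e.2 hne
  have ht : t e.1 ≠ v := fun h => ((hinc e.1).mp (Or.inr h)).elim e.2 hne
  simp only [hne, dite_false, if_false, restrict_eq a ψ _ hs, restrict_eq a ψ _ ht]
end

section
/- A d-class symmetric association scheme on a finite set X is triply regular if and only if for all 0 ≤ i, j, k ≤ d the tensor Wye(A_i, A_j, A_k) lies in the Delta-space of the scheme. -/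
open Finset

/-- A `d`-class symmetric association scheme on a finite set `X`, presented by its
adjacency matrices `A 0, …, A d` and intersection numbers `p i j k`:
symmetric 0-1 matrices with `A 0 = I`, summing to the all-ones matrix, pairwise
disjoint supports (`A i ∘ A j = δ_{ij} A i` entrywise), and
`A i * A j = Σ_k p i j k • A k`. -/
structure IsAssocScheme (X : Type) [Fintype X] [DecidableEq X] (d : ℕ)
    (A : Fin (d + 1) → Matrix X X ℂ)
    (p : Fin (d + 1) → Fin (d + 1) → Fin (d + 1) → ℕ) : Prop where
  symm : ∀ i, (A i).IsSymm
  zero_one : ∀ i x y, A i x y = 0 ∨ A i x y = 1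
  ident : A 0 = 1
  total : ∑ i, A i = Matrix.of fun _ _ => (1 : ℂ)
  schur : ∀ i j, Matrix.hadamard (A i) (A j) = if i = j then A i else 0
  mul_eq : ∀ i j, A i * A j = ∑ k, (p i j k : ℂ) • A k

/-- The third-order tensor `Delta(L,M,N)` with entries
`Delta(L,M,N)_{x,y,z} = L_{x,z} M_{x,y} N_{y,z}`. -/
def DeltaT {X : Type} (L M N : Matrix X X ℂ) : X × X × X → ℂ :=
  fun q => L q.1 q.2.2 * M q.1 q.2.1 * N q.2.1 q.2.2

/-- The third-order tensor `Wye(L,M,N)` with entries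
`Wye(L,M,N)_{x,y,z} = Σ_u L_{x,u} M_{y,u} N_{z,u}`. -/
noncomputable def WyeT {X : Type} [Fintype X] (L M N : Matrix X X ℂ) : X × X × X → ℂ :=
  fun q => ∑ u : X, L q.1 u * M q.2.1 u * N q.2.2 u

/-- The Bose–Mesner algebra: the span of the adjacency matrices. -/
noncomputable def BoseMesner {X : Type} {d : ℕ} (A : Fin (d + 1) → Matrix X X ℂ) :
    Submodule ℂ (Matrix X X ℂ) :=
  Submodule.span ℂ (Set.range A)

/-- The Delta-space: the span of all `Delta(L,M,N)` with `L, M, N` in the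
Bose–Mesner algebra. -/
noncomputable def DeltaSpace {X : Type} {d : ℕ} (A : Fin (d + 1) → Matrix X X ℂ) :
    Submodule ℂ (X × X × X → ℂ) :=
  Submodule.span ℂ
    {T | ∃ L ∈ BoseMesner A, ∃ M ∈ BoseMesner A, ∃ N ∈ BoseMesner A, T = DeltaT L M N}

/-- The Wye-space: the span of all `Wye(L,M,N)` with `L, M, N` in the
Bose–Mesner algebra. -/
noncomputable def WyeSpace {X : Type} [Fintype X] {d : ℕ} (A : Fin (d + 1) → Matrix X X ℂ) :
    Submodule ℂ (X × X × X → ℂ) :=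
  Submodule.span ℂ
    {T | ∃ L ∈ BoseMesner A, ∃ M ∈ BoseMesner A, ∃ N ∈ BoseMesner A, T = WyeT L M N}

namespace IsAssocScheme

variable {X : Type} [Fintype X] [DecidableEq X] {d : ℕ} {A : Fin (d + 1) → Matrix X X ℂ}
  {p : Fin (d + 1) → Fin (d + 1) → Fin (d + 1) → ℕ}

/-- Any two points are in some relation of the scheme. -/
lemma exists_rel (h : IsAssocScheme X d A p) (x y : X) : ∃ r, A r x y = 1 := by
  by_contra! hne
  have hzero : ∀ i, A i x y = 0 := fun i => (h.zero_one i x y).resolve_right (hne i)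
  have htotal := congrFun (congrFun h.total x) y
  simp [Matrix.sum_apply, hzero] at htotal

/-- The relation between two points determines all the adjacency entries at that pair. -/
lemma apply_eq_ite (h : IsAssocScheme X d A p) {r : Fin (d + 1)} {x y : X}
    (hr : A r x y = 1) (i : Fin (d + 1)) : A i x y = if i = r then 1 else 0 := by
  have hs := congrFun (congrFun (h.schur i r) x) y
  rw [Matrix.hadamard_apply, hr, mul_one] at hs
  split_ifs with hi
  · rw [hi, hr]
  · simpa [hi] using hs

/-- Members of the Bose–Mesner algebra are constant on each relation. -/
lemma boseMesner_apply_eq (h : IsAssocScheme X d A p) {L : Matrix X X ℂ}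
    (hL : L ∈ BoseMesner A) {r : Fin (d + 1)} {x y x' y' : X}
    (hr : A r x y = 1) (hr' : A r x' y' = 1) : L x y = L x' y' := by
  induction hL using Submodule.span_induction with
  | mem M hM =>
    obtain ⟨i, rfl⟩ := hM
    rw [h.apply_eq_ite hr, h.apply_eq_ite hr']
  | zero => rfl
  | add M N _ _ hM hN => simp only [Matrix.add_apply, hM, hN]
  | smul c M _ hM => simp only [Matrix.smul_apply, hM]

/-- Members of the Delta-space take equal values at triples with the same mutual relations. -/
lemma deltaSpace_apply_eq (h : IsAssocScheme X d A p) {T : X × X × X → ℂ}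
    (hT : T ∈ DeltaSpace A) {r s t : Fin (d + 1)} {x y z x' y' z' : X}
    (hr : A r x z = 1) (hs : A s x y = 1) (ht : A t y z = 1)
    (hr' : A r x' z' = 1) (hs' : A s x' y' = 1) (ht' : A t y' z' = 1) :
    T (x, y, z) = T (x', y', z') := by
  induction hT using Submodule.span_induction with
  | mem T hT =>
    obtain ⟨L, hL, M, hM, N, hN, rfl⟩ := hT
    simp only [DeltaT, h.boseMesner_apply_eq hL hr hr', h.boseMesner_apply_eq hM hs hs',
      h.boseMesner_apply_eq hN ht ht']
  | zero => rfl
  | add T U _ _ hT hU => simp only [Pi.add_apply, hT, hU]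
  | smul c T _ hT => simp only [Pi.smul_apply, hT]

/-- The entries of `Wye(A_i, A_j, A_k)` count the points in prescribed relations to a triple. -/
lemma wyeT_apply (h : IsAssocScheme X d A p) (i j k : Fin (d + 1)) (x y z : X) :
    WyeT (A i) (A j) (A k) (x, y, z) =
      (Nat.card {u : X // A i x u = 1 ∧ A j y u = 1 ∧ A k z u = 1} : ℂ) := by
  classical
  rw [Nat.card_eq_fintype_card, Fintype.card_subtype, ← Finset.sum_boole]
  refine Finset.sum_congr rfl fun u _ => ?_
  rcases h.zero_one i x u with hi | hi <;> rcases h.zero_one j y u with hj | hj <;>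
    rcases h.zero_one k z u with hk | hk <;> simp [hi, hj, hk]

end IsAssocScheme

lemma deltaT_mem_deltaSpace {X : Type} {d : ℕ} (A : Fin (d + 1) → Matrix X X ℂ)
    (r s t : Fin (d + 1)) : DeltaT (A r) (A s) (A t) ∈ DeltaSpace A :=
  Submodule.subset_span ⟨A r, Submodule.subset_span ⟨r, rfl⟩, A s, Submodule.subset_span ⟨s, rfl⟩,
    A t, Submodule.subset_span ⟨t, rfl⟩, rfl⟩

/-- A `d`-class symmetric association scheme is triply regular
(the number of `u` with `x R_i u`, `y R_j u`, `z R_k u` depends only on `i, j, k` and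
the three relations joining `x, y, z`) if and only if every tensor
`Wye(A_i, A_j, A_k)` lies in the Delta-space of the scheme. -/
theorem stmt_6 {X : Type} [Fintype X] [DecidableEq X] {d : ℕ}
    {A : Fin (d + 1) → Matrix X X ℂ} {p : Fin (d + 1) → Fin (d + 1) → Fin (d + 1) → ℕ}
    (h : IsAssocScheme X d A p) :
    (∀ i j k r s t : Fin (d + 1), ∃ υ : ℕ, ∀ x y z : X,
        A r x z = 1 → A s x y = 1 → A t y z = 1 →
        Nat.card {u : X // A i x u = 1 ∧ A j y u = 1 ∧ A k z u = 1} = υ) ↔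
      (∀ i j k : Fin (d + 1), WyeT (A i) (A j) (A k) ∈ DeltaSpace A) := by
  constructor
  · intro htriple i j k
    choose υ hυ using htriple i j k
    have hexpand : WyeT (A i) (A j) (A k) =
        ∑ r, ∑ s, ∑ t, (υ r s t : ℂ) • DeltaT (A r) (A s) (A t) := by
      funext ⟨x, y, z⟩
      obtain ⟨r, hr⟩ := h.exists_rel x z
      obtain ⟨s, hs⟩ := h.exists_rel x y
      obtain ⟨t, ht⟩ := h.exists_rel y z
      rw [h.wyeT_apply, hυ r s t x y z hr hs ht]
      simp [Finset.sum_apply, DeltaT, h.apply_eq_ite hr, h.apply_eq_ite hs, h.apply_eq_ite ht]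
    rw [hexpand]
    exact Submodule.sum_mem _ fun r _ => Submodule.sum_mem _ fun s _ =>
      Submodule.sum_mem _ fun t _ => Submodule.smul_mem _ _ (deltaT_mem_deltaSpace A r s t)
  · intro hwye i j k r s t
    by_cases hex : ∃ x y z, A r x z = 1 ∧ A s x y = 1 ∧ A t y z = 1
    · obtain ⟨x, y, z, hr, hs, ht⟩ := hex
      refine ⟨Nat.card {u : X // A i x u = 1 ∧ A j y u = 1 ∧ A k z u = 1},
        fun x' y' z' hr' hs' ht' => ?_⟩
      have heq := h.deltaSpace_apply_eq (hwye i j k) hr' hs' ht' hr hs ht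
      rw [h.wyeT_apply, h.wyeT_apply] at heq
      exact_mod_cast heq
    · exact ⟨0, fun x y z hr hs ht => (hex ⟨x, y, z, hr, hs, ht⟩).elim⟩
end
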